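/- Let n ≥ 1, let φ : ℝⁿ → ℝ be twice continuously differentiable with ∇²φ(x) positive definite for every x ∈ ℝⁿ, let D : ℝⁿ ⇉ ℝⁿ be a locally bounded set-valued mapping with closed graph and nonempty compact convex values, let f : ℝⁿ → ℝ, let τ > 0, and define h(x, m) = f(x) + ‖m‖²/(2τ). Let (x, m) : [0, ∞) → ℝⁿ × ℝⁿ be locally Lipschitz and suppose: (i) for almost every t ≥ 0, x and m are differentiable at t, ẋ(t) = −(∇²φ(x(t)))⁻¹ m(t), and ṁ(t) ∈ −τ (∇²φ(x(t)))⁻¹ (m(t) − D(x(t))); (ii) for almost every t ≥ 0, the function s ↦ f(x(s)) is differentiable at t with derivative equal to ⟨v, ẋ(t)⟩ for every v ∈ D(x(t)); (iii) f∘x, x, and m each equal the integral of their almost-everywhere derivatives, i.e. for all 0 ≤ t₁ ≤ t₂, f(x(t₂)) − f(x(t₁)) = ∫_{t₁}^{t₂} (f∘x)'(s) ds, x(t₂) − x(t₁) = ∫_{t₁}^{t₂} ẋ(s) ds, and m(t₂) − m(t₁) = ∫_{t₁}^{t₂} ṁ(s) ds. Then t ↦ h(x(t), m(t)) is nonincreasing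 on [0, ∞), and if it is not the case that both m(0) = 0 and 0 ∈ D(x(0)), then there exists T > 0 such that h(x(T), m(T)) < h(x(0), m(0)). -/

import Mathlib

open Filter Topology Metric MeasureTheory
open scoped Pointwise

/-- The Hessian of `φ` at `x`, viewed as a continuous linear map (the Fréchet derivative
of the gradient map). -/
noncomputable def hess {n : ℕ} (φ : EuclideanSpace ℝ (Fin n) → ℝ)
    (x : EuclideanSpace ℝ (Fin n)) :
    EuclideanSpace ℝ (Fin n) →L[ℝ] EuclideanSpace ℝ (Fin n) :=
  fderiv ℝ (gradient φ) x

open scoped RealInnerProductSpace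

theorem ContDiff.inner_fderiv_gradient {F : Type*} [NormedAddCommGroup F]
    [InnerProductSpace ℝ F] [CompleteSpace F] {φ : F → ℝ} (hφ : ContDiff ℝ 2 φ) (x v w : F) :
    ⟪fderiv ℝ (gradient φ) x v, w⟫ = fderiv ℝ (fderiv ℝ φ) x v w := by
  have h : HasFDerivAt (gradient φ) _ x :=
    (InnerProductSpace.toDual ℝ F).symm.toContinuousLinearEquiv.hasFDerivAt.comp x
      ((hφ.fderiv_right (m := 1) (by norm_num)).differentiable (by norm_num) x).hasFDerivAt
  rw [h.fderiv]
  exact InnerProductSpace.toDual_symm_apply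

section Hessian

variable {n : ℕ} {φ : EuclideanSpace ℝ (Fin n) → ℝ}

theorem ContDiff.continuous_hess (hφ : ContDiff ℝ 2 φ) : Continuous (hess φ) :=
  ((InnerProductSpace.toDual ℝ _).symm.toContinuousLinearEquiv.contDiff.comp
    (hφ.fderiv_right (m := 1) (by norm_num))).continuous_fderiv (by norm_num)

theorem ContDiff.inner_hess_comm (hφ : ContDiff ℝ 2 φ) (x v w : EuclideanSpace ℝ (Fin n)) :
    ⟪hess φ x v, w⟫ = ⟪v, hess φ x w⟫ := by
  rw [← real_inner_comm v, hess, hφ.inner_fderiv_gradient, hφ.inner_fderiv_gradient]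
  exact (hφ.contDiffAt.isSymmSndFDerivAt (by simp)).eq v w

theorem ContinuousLinearMap.isInvertible_of_inner_pos {F : Type*} [NormedAddCommGroup F]
    [InnerProductSpace ℝ F] [FiniteDimensional ℝ F] {A : F →L[ℝ] F}
    (hA : ∀ v, v ≠ 0 → 0 < ⟪v, A v⟫) : A.IsInvertible := by
  have hinj : Function.Injective (A : F →ₗ[ℝ] F) := by
    refine (injective_iff_map_eq_zero _).2 fun v hv => ?_
    by_contra h
    have hpos := hA v h
    rw [show A v = 0 from hv, inner_zero_right] at hpos
    exact hpos.false
  refine ⟨(LinearEquiv.ofInjectiveEndo (A : F →ₗ[ℝ] F) hinj).toContinuousLinearEquiv, ?_⟩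
  ext v
  rfl

theorem ContinuousLinearMap.inner_inverse_pos {F : Type*} [NormedAddCommGroup F]
    [InnerProductSpace ℝ F] [FiniteDimensional ℝ F] {A : F →L[ℝ] F}
    (hA : ∀ v, v ≠ 0 → 0 < ⟪v, A v⟫) {w : F} (hw : w ≠ 0) : 0 < ⟪w, A.inverse w⟫ := by
  have hinv := isInvertible_of_inner_pos hA
  have h := hA (A.inverse w) fun h0 => hw (by
    rw [← hinv.self_apply_inverse w, h0, map_zero])
  rwa [hinv.self_apply_inverse, real_inner_comm] at h

theorem ContinuousLinearMap.inner_inverse_comm {F : Type*} [NormedAddCommGroup F]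
    [InnerProductSpace ℝ F] {A : F →L[ℝ] F} (hA : A.IsInvertible)
    (hsymm : ∀ v w, ⟪A v, w⟫ = ⟪v, A w⟫) (v w : F) :
    ⟪A.inverse v, w⟫ = ⟪v, A.inverse w⟫ := by
  have h := hsymm (A.inverse v) (A.inverse w)
  rw [hA.self_apply_inverse, hA.self_apply_inverse] at h
  exact h.symm

theorem ContDiff.continuous_inverse_hess (hφ : ContDiff ℝ 2 φ)
    (hpos : ∀ x v : EuclideanSpace ℝ (Fin n), v ≠ 0 → 0 < ⟪v, hess φ x v⟫) :
    Continuous fun x => (hess φ x).inverse :=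
  continuous_iff_continuousAt.2 fun x =>
    ContinuousAt.comp
      (((ContinuousLinearMap.isInvertible_of_inner_pos (hpos x)).contDiffAt_map_inverse
        (n := 0)).continuousAt)
      hφ.continuous_hess.continuousAt

end Hessian

theorem IsCompact.isBounded_biUnion_of_locally {α β : Type*} [PseudoMetricSpace α] [Bornology β]
    {K : Set α} (hK : IsCompact K) {D : α → Set β}
    (hD : ∀ x, ∃ ε : ℝ, 0 < ε ∧ Bornology.IsBounded (⋃ y ∈ Metric.ball x ε, D y)) :
    Bornology.IsBounded (⋃ y ∈ K, D y) := by
  refine hK.induction_on (p := fun s => Bornology.IsBounded (⋃ y ∈ s, D y)) (by simp)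
    (fun s t hst ht => ht.subset (Set.biUnion_subset_biUnion_left hst))
    (fun s t hs ht => by rw [Set.biUnion_union]; exact hs.union ht) fun x _ => ?_
  obtain ⟨ε, hε, hb⟩ := hD x
  exact ⟨_, mem_nhdsWithin_of_mem_nhds (Metric.ball_mem_nhds x hε), hb⟩

/-- An integral of an almost everywhere bounded function is absolutely continuous, without any
measurability assumption on the integrand. -/
theorem absolutelyContinuousOnInterval_of_sub_eq_integral {F g : ℝ → ℝ} {a b C : ℝ} (hab : a ≤ b)
    (hF : ∀ s t, a ≤ s → s ≤ t → F t - F s = ∫ r in s..t, g r)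
    (hg : ∀ᵐ r, r ∈ Set.Icc a b → ‖g r‖ ≤ C) : AbsolutelyContinuousOnInterval F a b := by
  have key : ∀ s t, a ≤ s → s ≤ t → t ≤ b → |F t - F s| ≤ C * |t - s| := by
    intro s t hs hst ht
    rw [hF s t hs hst, ← Real.norm_eq_abs]
    refine intervalIntegral.norm_integral_le_of_norm_le_const_ae ?_
    filter_upwards [hg] with r hr hrm
    rw [Set.uIoc_of_le hst] at hrm
    exact hr ⟨hs.trans hrm.1.le, hrm.2.trans ht⟩
  refine LipschitzOnWith.absolutelyContinuousOnInterval (K := C.toNNReal)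
    (LipschitzOnWith.of_dist_le' ?_)
  rw [Set.uIcc_of_le hab]
  intro s hs t ht
  rw [Real.dist_eq, Real.dist_eq]
  rcases le_total s t with h | h
  · rw [abs_sub_comm, abs_sub_comm s]
    exact key s t hs.1 h ht.2
  · exact key t s ht.1 h hs.2

/-- Lyapunov descent for the momentum differential inclusion: with
`h(x, m) = f(x) + ‖m‖²/(2τ)`, along any trajectory `(x, m)` of
`ẋ = −(∇²φ(x))⁻¹ m`, `ṁ ∈ −τ(∇²φ(x))⁻¹(m − D(x))`, the value `h(x(t), m(t))` is
nonincreasing, and if not both `m(0) = 0` and `0 ∈ D(x(0))` then it strictly decreases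
at some `T > 0`. -/
theorem stmt6 (n : ℕ) (hn : 1 ≤ n)
    (φ : EuclideanSpace ℝ (Fin n) → ℝ) (hφ : ContDiff ℝ 2 φ)
    (hpos : ∀ x v : EuclideanSpace ℝ (Fin n), v ≠ 0 → 0 < (inner ℝ v (hess φ x v) : ℝ))
    (D : EuclideanSpace ℝ (Fin n) → Set (EuclideanSpace ℝ (Fin n)))
    (hlocbd : ∀ x : EuclideanSpace ℝ (Fin n), ∃ ε : ℝ, 0 < ε ∧
      Bornology.IsBounded (⋃ y ∈ Metric.ball x ε, D y))
    (hgraph : IsClosed {p : EuclideanSpace ℝ (Fin n) × EuclideanSpace ℝ (Fin n) |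
        p.2 ∈ D p.1})
    (hne : ∀ x, (D x).Nonempty) (hcp : ∀ x, IsCompact (D x)) (hcv : ∀ x, Convex ℝ (D x))
    (f : EuclideanSpace ℝ (Fin n) → ℝ) (τ : ℝ) (hτ : 0 < τ)
    (x m : ℝ → EuclideanSpace ℝ (Fin n))
    (hxlip : LocallyLipschitzOn (Set.Ici (0 : ℝ)) x)
    (hmlip : LocallyLipschitzOn (Set.Ici (0 : ℝ)) m)
    (x' m' : ℝ → EuclideanSpace ℝ (Fin n)) (fx' : ℝ → ℝ)
    -- (i): a.e. derivatives and the differential inclusion.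
    (hi : ∀ᵐ t ∂(volume.restrict (Set.Ici (0 : ℝ))),
      HasDerivAt x (x' t) t ∧ HasDerivAt m (m' t) t ∧
      x' t = -((hess φ (x t)).inverse (m t)) ∧
      m' t ∈ -(τ • ((hess φ (x t)).inverse '' ({m t} - D (x t)))))
    -- (ii): a.e. chain rule for f ∘ x.
    (hii : ∀ᵐ t ∂(volume.restrict (Set.Ici (0 : ℝ))),
      HasDerivAt (fun s => f (x s)) (fx' t) t ∧
      ∀ v ∈ D (x t), fx' t = (inner ℝ v (x' t) : ℝ))
    -- (iii): fundamental theorem of calculus for f ∘ x, x and m.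
    (hiii : ∀ t₁ t₂ : ℝ, 0 ≤ t₁ → t₁ ≤ t₂ →
      (f (x t₂) - f (x t₁) = ∫ s in t₁..t₂, fx' s) ∧
      (x t₂ - x t₁ = ∫ s in t₁..t₂, x' s) ∧
      (m t₂ - m t₁ = ∫ s in t₁..t₂, m' s)) :
    AntitoneOn (fun t => f (x t) + ‖m t‖ ^ 2 / (2 * τ)) (Set.Ici (0 : ℝ)) ∧
    (¬ (m 0 = 0 ∧ (0 : EuclideanSpace ℝ (Fin n)) ∈ D (x 0)) →
      ∃ T : ℝ, 0 < T ∧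
        f (x T) + ‖m T‖ ^ 2 / (2 * τ) < f (x 0) + ‖m 0‖ ^ 2 / (2 * τ)) := by
  have hinv := fun y => ContinuousLinearMap.isInvertible_of_inner_pos (hpos y)
  have hsymm := fun y => ContinuousLinearMap.inner_inverse_comm (hinv y) (hφ.inner_hess_comm y)
  have hxc : ContinuousOn x (Set.Ici 0) := hxlip.continuousOn
  have hmc : ContinuousOn m (Set.Ici 0) := hmlip.continuousOn
  have hyc : ContinuousOn (fun t => (hess φ (x t)).inverse (m t)) (Set.Ici 0) :=
    ((hφ.continuous_inverse_hess hpos).comp_continuousOn hxc).clm_apply hmc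
  set g : ℝ → ℝ := fun t => ⟪m t, (hess φ (x t)).inverse (m t)⟫ with hg
  have hgc : ContinuousOn g (Set.Ici 0) := hmc.inner hyc
  set H : ℝ → ℝ := fun t => f (x t) + ‖m t‖ ^ 2 / (2 * τ) with hH
  have hg0 : ∀ t, 0 ≤ g t := by
    intro t
    rcases eq_or_ne (m t) 0 with h | h
    · simp [hg, h]
    · exact (ContinuousLinearMap.inner_inverse_pos (hpos (x t)) h).le
  rw [ae_restrict_iff' measurableSet_Ici] at hi hii
  have hderiv : ∀ᵐ t, t ∈ Set.Ici (0 : ℝ) → HasDerivAt H (-g t) t := by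
    filter_upwards [hi, hii] with t h1 h2 ht
    obtain ⟨-, hm', hx, hmem⟩ := h1 ht
    obtain ⟨hf', hv⟩ := h2 ht
    obtain ⟨w, ⟨u, ⟨m₀, hm₀, v, hvD, rfl⟩, rfl⟩, hw⟩ := hmem
    obtain rfl : m₀ = m t := hm₀
    refine (hf'.add (hm'.norm_sq.div_const (2 * τ))).congr_deriv ?_
    have hw' : m' t = -(τ • (hess φ (x t)).inverse (m t - v)) := by
      rw [← neg_neg (m' t), ← hw]
    rw [hv v hvD, hx, hw', map_sub, inner_neg_right, inner_neg_right, inner_smul_right,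
      inner_sub_right, ← hsymm (x t) (m t) v, real_inner_comm v]
    simp only [hg]
    field_simp
    ring
  have hac : ∀ b, 0 ≤ b → AbsolutelyContinuousOnInterval H 0 b := by
    intro b hb
    have hsub : Set.Icc 0 b ⊆ Set.Ici (0 : ℝ) := Set.Icc_subset_Ici_self
    obtain ⟨K, hK⟩ := (hmlip.mono hsub).exists_lipschitzOnWith_of_compact isCompact_Icc
    have hn : AbsolutelyContinuousOnInterval (fun t => ‖m t‖) 0 b := by
      refine LipschitzOnWith.absolutelyContinuousOnInterval (K := 1 * K) ?_
      rw [Set.uIcc_of_le hb]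
      exact lipschitzWith_one_norm.comp_lipschitzOnWith hK
    obtain ⟨C₁, hC₁⟩ := isCompact_Icc.exists_bound_of_continuousOn (hyc.mono hsub)
    obtain ⟨C₂, hC₂⟩ := ((isCompact_Icc.image_of_continuousOn
      (hxc.mono hsub)).isBounded_biUnion_of_locally hlocbd).exists_norm_le
    have hfac : AbsolutelyContinuousOnInterval (fun t => f (x t)) 0 b := by
      refine absolutelyContinuousOnInterval_of_sub_eq_integral (C := C₂ * C₁) hb
        (fun s t hs hst => (hiii s t hs hst).1) ?_
      filter_upwards [hi, hii] with t h1 h2 ht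
      obtain ⟨v, hv⟩ := hne (x t)
      have hvC := hC₂ v (Set.mem_biUnion (Set.mem_image_of_mem x ht) hv)
      rw [(h2 ht.1).2 v hv, (h1 ht.1).2.2.1, inner_neg_right, norm_neg]
      exact (norm_inner_le_norm _ _).trans
        (mul_le_mul hvC (hC₁ t ht) (norm_nonneg _) ((norm_nonneg _).trans hvC))
    have hH' : H = fun t => f (x t) + (2 * τ)⁻¹ * (‖m t‖ * ‖m t‖) := by
      funext t
      simp only [hH]
      field_simp
    rw [hH']
    exact hfac.fun_add ((hn.fun_mul hn).const_mul (2 * τ)⁻¹)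
  have hint : ∀ b, 0 ≤ b → ∫ t in 0..b, g t = H 0 - H b := by
    intro b hb
    have h := (hac b hb).integral_deriv_eq_sub
    have h2 : ∫ t in 0..b, deriv H t = ∫ t in 0..b, -g t := by
      refine intervalIntegral.integral_congr_ae ?_
      filter_upwards [hderiv] with t ht htm
      rw [Set.uIoc_of_le hb] at htm
      exact (ht htm.1.le).deriv
    rw [h2, intervalIntegral.integral_neg] at h
    linarith
  have hgi : ∀ a b, 0 ≤ a → 0 ≤ b → IntervalIntegrable g volume a b := fun a b ha hb =>
    (hgc.mono ((Set.ordConnected_Ici.uIcc_subset ha hb))).intervalIntegrable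
  have hanti : AntitoneOn H (Set.Ici 0) := by
    intro s hs t ht hst
    have h := intervalIntegral.integral_add_adjacent_intervals (hgi 0 s le_rfl hs) (hgi s t hs ht)
    rw [hint s hs, hint t ht] at h
    have := intervalIntegral.integral_nonneg hst (fun u _ => hg0 u) (μ := volume)
    linarith
  refine ⟨hanti, fun hcrit => ?_⟩
  by_contra! hcon
  refine hcrit ?_
  have hm0 : ∀ t, 0 ≤ t → m t = 0 := by
    intro t ht
    by_contra hne0
    have hgt : 0 < g t := by
      exact ContinuousLinearMap.inner_inverse_pos (hpos (x t)) hne0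
    have hb : 0 < t + 1 := by linarith
    have hlt := intervalIntegral.integral_pos hb (hgc.mono Set.Icc_subset_Ici_self)
      (fun u _ => hg0 u) ⟨t, ⟨ht, by linarith⟩, hgt⟩
    rw [hint _ hb.le] at hlt
    have := hcon (t + 1) hb
    linarith
  have hx0 : ∀ t, 0 ≤ t → x t = x 0 := by
    intro t ht
    rw [← sub_eq_zero, (hiii 0 t le_rfl ht).2.1]
    refine intervalIntegral.integral_zero_ae ?_
    filter_upwards [hi] with s hs hsm
    rw [Set.uIoc_of_le ht] at hsm
    rw [(hs hsm.1.le).2.2.1, hm0 s hsm.1.le, map_zero, neg_zero]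
  refine ⟨hm0 0 le_rfl, ?_⟩
  obtain ⟨t, ht0, ht⟩ := ((frequently_ae_mem_iff.2 (by simp) :
    ∃ᵐ t : ℝ, t ∈ Set.Ioi (0 : ℝ)).and_eventually hi).exists
  obtain ⟨-, hm', -, hmem⟩ := ht (Set.Ioi_subset_Ici_self ht0)
  have hm'0 : m' t = 0 := hm'.unique ((hasDerivAt_const t 0).congr_of_eventuallyEq
    (by filter_upwards [Ioi_mem_nhds ht0] with s hs using hm0 s (le_of_lt hs)))
  obtain ⟨w, ⟨u, ⟨m₀, hm₀, v, hvD, rfl⟩, rfl⟩, hw⟩ := hmem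
  obtain rfl : m₀ = m t := hm₀
  have hzero : (hess φ (x t)).inverse (m t - v) = 0 := by
    rw [hm'0, neg_zero] at hw
    exact (smul_eq_zero.1 hw).resolve_left hτ.ne'
  have hv0 : v = 0 := by
    have h := (hinv (x t)).self_apply_inverse (m t - v)
    rw [hzero, map_zero, hm0 t (le_of_lt ht0), zero_sub] at h
    exact neg_eq_zero.1 h.symm
  rwa [← hx0 t (le_of_lt ht0), ← hv0]
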